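/- (Linear independence via Baker's theorem.) Let N ≥ 2 be an integer with N ≠ 6 and let ξ ∈ ℂ be a primitive N-th root of unity. Then the complex numbers log(1−ξ) (principal branch) and πi are linearly independent over ℚ, and the triple 1, log(1−ξ), πi is linearly independent over the field ℚ̄ of algebraic numbers (the algebraic closure of ℚ inside ℂ). -/

import Mathlib

open scoped BigOperators

noncomputable section

/-- Letters of the alphabet: `none` is `x₀`, `some ξ` is `x_ξ`. -/
abbrev Letter : Type := Option ℂ

/-- The set of `N`-th roots of unity in `ℂ`. -/
def Gamma (N : ℕ) : Set ℂ := {z : ℂ | z ^ N = 1}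

/-- The `N`-th cyclotomic field, as a subfield of `ℂ`. -/
def KN (N : ℕ) : IntermediateField ℚ ℂ := IntermediateField.adjoin ℚ (Gamma N)

/-- weight of an index -/
def wt {r : ℕ} (k : Fin r → ℕ) : ℕ := ∑ i, k i

/-- the cyclotomic multiple zeta value, as a convergent series -/
def cmzv {r : ℕ} (k : Fin r → ℕ) (ξ : Fin r → ℂ) : ℂ :=
  ∑' m : {m : Fin r → ℕ // StrictMono m ∧ ∀ i, 0 < m i},
    ∏ i, ξ i ^ (m.val i) / ((m.val i : ℂ) ^ k i)

/-- admissibility of a pair `(k, ξ)` -/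
def Admissible (N : ℕ) {r : ℕ} (k : Fin r → ℕ) (ξ : Fin r → ℂ) : Prop :=
  (∀ i, 0 < k i) ∧ (∀ i, ξ i ∈ Gamma N) ∧
    ∀ h : 0 < r, ¬(k ⟨r - 1, Nat.sub_lt h one_pos⟩ = 1 ∧ ξ ⟨r - 1, Nat.sub_lt h one_pos⟩ = 1)

/-- `π i` -/
def piI : ℂ := (Real.pi : ℂ) * Complex.I

/-- `Z̃^N`, the `K_N`-algebra generated by `πi` and all CMZVs -/
def Ztilde (N : ℕ) : Subalgebra (KN N) ℂ :=
  Algebra.adjoin (KN N)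
    ({piI} ∪ {z : ℂ | ∃ (r : ℕ) (k : Fin r → ℕ) (ξ : Fin r → ℂ), Admissible N k ξ ∧ z = cmzv k ξ})

/-- weight-`w` part `Z̃^N_w` -/
def ZtildeW (N w : ℕ) : Submodule (KN N) ℂ :=
  Submodule.span (KN N)
    {z : ℂ | ∃ (s r : ℕ) (k : Fin r → ℕ) (ξ : Fin r → ℂ),
      Admissible N k ξ ∧ wt k + s = w ∧ z = piI ^ s * cmzv k ξ}

/-- weight-`w`, depth-`≤ d` part `Z̃^N_{w,d}` -/
def ZtildeWR (N w d : ℕ) : Submodule (KN N) ℂ :=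
  Submodule.span (KN N)
    {z : ℂ | ∃ (s r : ℕ) (k : Fin r → ℕ) (ξ : Fin r → ℂ),
      r ≤ d ∧ Admissible N k ξ ∧ wt k + s = w ∧ z = piI ^ s * cmzv k ξ}

/-- the space `PD^N_{w,d}` -/
def PD (N w d : ℕ) : Submodule (KN N) ℂ :=
  ZtildeWR N w (d - 1) ⊔
    ⨆ (w₁ : ℕ) (w₂ : ℕ) (_ : w₁ + w₂ = w) (_ : 0 < w₁) (_ : 0 < w₂)
      (r₁ : ℕ) (r₂ : ℕ) (_ : r₁ + r₂ ≤ d) (_ : 0 < r₁) (_ : 0 < r₂),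
      ZtildeWR N w₁ r₁ * ZtildeWR N w₂ r₂

/-- multiplication of a subspace of `ℂ` by a fixed complex number -/
def cMul (N : ℕ) (c : ℂ) (S : Submodule (KN N) ℂ) : Submodule (KN N) ℂ :=
  Submodule.map (LinearMap.mulLeft (KN N) c) S

/-- the shuffle product of two words, as a multiset of words -/
def sh : List Letter → List Letter → Multiset (List Letter)
  | [], v => {v}
  | u, [] => {u}
  | a :: u, b :: v =>
      ((sh u (b :: v)).map fun w => a :: w) + ((sh (a :: u) v).map fun w => b :: w)
termination_by u v => u.length + v.length

/-- all letters of the word are in the alphabet `{x₀} ∪ {x_ξ : ξ ∈ Γ_N}` -/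
def InAlphabet (N : ℕ) (w : List Letter) : Prop :=
  ∀ l ∈ w, ∀ ξ : ℂ, l = some ξ → ξ ∈ Gamma N

/-- words spanning `h¹_N`: empty, or starting with some `x_ξ` -/
def IsH1Word (N : ℕ) (w : List Letter) : Prop :=
  InAlphabet N w ∧ (w = [] ∨ ∃ (ξ : ℂ) (t : List Letter), ξ ∈ Gamma N ∧ w = some ξ :: t)

/-- words spanning `h⁰_N`: words of `h¹_N` not ending in `x₁` -/
def IsH0Word (N : ℕ) (w : List Letter) : Prop :=
  IsH1Word N w ∧ w.getLast? ≠ some (some (1 : ℂ))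

/-- the word `x_{ξ₁} x₀^{k₁ - 1} ⋯ x_{ξ_r} x₀^{k_r - 1}` -/
def wordOf {r : ℕ} (k : Fin r → ℕ) (ξ : Fin r → ℂ) : List Letter :=
  (List.ofFn fun i : Fin r => (some (ξ i)) :: List.replicate (k i - 1) (none : Letter)).flatten

/-- `ξ ↦ (ξ₁ξ₂⁻¹, …, ξ_r ξ_{r+1}⁻¹)` with `ξ_{r+1} = 1` -/
def divNext {r : ℕ} (ξ : Fin r → ℂ) : Fin r → ℂ :=
  fun i => ξ i / (if h : (i : ℕ) + 1 < r then ξ ⟨(i : ℕ) + 1, h⟩ else 1)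

/-- `ξ ↦ (ξ₁⋯ξ_r, ξ₂⋯ξ_r, …, ξ_r)` -/
def suffixProd {r : ℕ} (ξ : Fin r → ℂ) : Fin r → ℂ :=
  fun i => ∏ j : Fin r, if i ≤ j then ξ j else 1

/-- The defining properties of the `K_N`-linear regularization map `Z^⧢_N : h¹_N → ℂ`,
expressed via its values `F` on the basis words of `h¹_N`: it is an algebra homomorphism
for the shuffle product, it restricts to `Z_N` on `h⁰_N`, and it sends `x₁` to `0`. -/
structure IsRegMap (N : ℕ) (F : List Letter → ℂ) : Prop where
  shuffle_mul : ∀ u v : List Letter, IsH1Word N u → IsH1Word N v →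
    ((sh u v).map F).sum = F u * F v
  restrict : ∀ (r : ℕ) (k : Fin r → ℕ) (ξ : Fin r → ℂ), (∀ i, 0 < k i) →
    (∀ i, ξ i ∈ Gamma N) → (wordOf k ξ).getLast? ≠ some (some (1 : ℂ)) →
    F (wordOf k ξ) = cmzv k (divNext ξ)
  x1_eq_zero : F [some (1 : ℂ)] = 0

/-- the `⧢`-regularized CMZV `ζ^⧢(ξ; k) = Z^⧢(x_{ξ₁⋯ξ_r} x₀^{k₁-1} ⋯ x_{ξ_r} x₀^{k_r-1})` -/
def regCMZV (F : List Letter → ℂ) {r : ℕ} (k : Fin r → ℕ) (ξ : Fin r → ℂ) : ℂ :=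
  F (wordOf k (suffixProd ξ))

/-- first `j` entries of a tuple -/
def takeIdx {A : Type*} {r : ℕ} (k : Fin r → A) (j : ℕ) (h : j ≤ r) : Fin j → A :=
  fun t => k ⟨t, lt_of_lt_of_le t.2 h⟩

/-- last `r - j` entries of a tuple, in reversed order -/
def dropRevIdx {A : Type*} {r : ℕ} (k : Fin r → A) (j : ℕ) (h : j ≤ r) : Fin (r - j) → A :=
  fun t => k ⟨r - 1 - (t : ℕ), by have := t.2; omega⟩

/-- the `⧢`-regularized cyclotomic symmetric multiple zeta value `ζ^{S(N,α),⧢}(ξ; k)` -/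
def csmzvSh (N : ℕ) (α : ZMod N) (F : List Letter → ℂ) {r : ℕ}
    (k : Fin r → ℕ) (ξ : Fin r → ℂ) : ℂ :=
  ∑ j : Fin (r + 1),
    (∏ i : Fin r, if (j : ℕ) ≤ (i : ℕ) then ξ i else 1) ^ α.val *
      (-1 : ℂ) ^ (∑ i : Fin r, if (j : ℕ) ≤ (i : ℕ) then k i else 0) *
      (regCMZV F (takeIdx k j j.is_le) (takeIdx ξ j j.is_le) *
        regCMZV F (dropRevIdx k j j.is_le)
          (fun t => starRingEnd ℂ (dropRevIdx ξ j j.is_le t)))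

/-- the `K_N`-span `Z^{S(N,α),⧢}` of all `⧢`-CSMZVs -/
def ZSsh (N : ℕ) (α : ZMod N) (F : List Letter → ℂ) : Submodule (KN N) ℂ :=
  Submodule.span (KN N)
    {z : ℂ | ∃ (r : ℕ) (k : Fin r → ℕ) (ξ : Fin r → ℂ),
      (∀ i, 0 < k i) ∧ (∀ i, ξ i ∈ Gamma N) ∧ z = csmzvSh N α F k ξ}

/-- the `K_N`-span `Z^{S(N,α),⧢}_w` of the `⧢`-CSMZVs of weight `w` -/
def ZSshW (N : ℕ) (α : ZMod N) (F : List Letter → ℂ) (w : ℕ) : Submodule (KN N) ℂ :=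
  Submodule.span (KN N)
    {z : ℂ | ∃ (r : ℕ) (k : Fin r → ℕ) (ξ : Fin r → ℂ),
      (∀ i, 0 < k i) ∧ (∀ i, ξ i ∈ Gamma N) ∧ wt k = w ∧ z = csmzvSh N α F k ξ}

open Polynomial in
/-- The Euler operator `X · d/dX` on polynomials. -/
def eulerOp {F : Type*} [CommRing F] (P : F[X]) : F[X] := X * derivative P

open Polynomial in
theorem coeff_eulerOp_iterate {F : Type*} [CommRing F] (P : F[X]) (a k : ℕ) :
    (eulerOp^[a] P).coeff k = (k : F) ^ a * P.coeff k := by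
  induction a generalizing k with
  | zero => simp
  | succ a ih =>
    rw [Function.iterate_succ_apply']
    have h : ∀ Q : F[X], (eulerOp Q).coeff k = (k : F) * Q.coeff k := by
      intro Q
      cases k with
      | zero => simp [eulerOp]
      | succ k => simp [eulerOp, coeff_X_mul, coeff_derivative, mul_comm]
    rw [h, ih]
    ring

open Polynomial in
theorem eval_eulerOp_iterate {F : Type*} [CommRing F] (P : F[X]) (a n : ℕ)
    (hP : P.degree < n) (x : F) :
    (eulerOp^[a] P).eval x = ∑ k ∈ Finset.range n, P.coeff k * ((k : F) ^ a * x ^ k) := by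
  have hd : (eulerOp^[a] P).degree < n := by
    rw [degree_lt_iff_coeff_zero] at hP ⊢
    intro m hm
    rw [coeff_eulerOp_iterate, hP m hm, mul_zero]
  by_cases h0 : eulerOp^[a] P = 0
  · rw [h0, eval_zero]
    refine (Finset.sum_eq_zero fun k _ => ?_).symm
    have := coeff_eulerOp_iterate P a k
    rw [h0, coeff_zero] at this
    linear_combination -x ^ k * this
  rw [eval_eq_sum_range' ((natDegree_lt_iff_degree_lt h0).2 hd)]
  refine Finset.sum_congr rfl fun k _ => ?_
  rw [coeff_eulerOp_iterate]
  ring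

open Polynomial in
theorem eval_eulerOp_iterate_X_sub_C_pow_mul {F : Type*} [CommRing F] (x : F) (m : ℕ)
    (R : F[X]) :
    (eulerOp^[m] ((X - C x) ^ m * R)).eval x = m.factorial * x ^ m * R.eval x := by
  induction m generalizing R with
  | zero => simp
  | succ m ih =>
    rw [Function.iterate_succ_apply]
    have h : eulerOp ((X - C x) ^ (m + 1) * R) =
        (X - C x) ^ m * (((m + 1 : ℕ) : F[X]) * X * R + (X - C x) * X * derivative R) := by
      simp only [eulerOp, derivative_mul, derivative_X_sub_C_pow]
      simp only [Nat.add_sub_cancel, map_natCast]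
      ring
    rw [h, ih]
    simp only [eval_add, eval_mul, eval_natCast, eval_X, eval_sub, eval_C, Nat.factorial_succ]
    push_cast
    ring

open Polynomial in
theorem eval_eulerOp_iterate_eq_zero {F : Type*} [CommRing F] (x : F) (a m : ℕ) (h : a < m)
    (P : F[X]) (hP : (X - C x) ^ m ∣ P) : (eulerOp^[a] P).eval x = 0 := by
  obtain ⟨R, rfl⟩ := hP
  obtain ⟨d, rfl⟩ := Nat.exists_eq_add_of_lt h
  have : (X - C x) ^ (a + d + 1) * R = (X - C x) ^ a * ((X - C x) ^ (d + 1) * R) := by ring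
  rw [this, eval_eulerOp_iterate_X_sub_C_pow_mul]
  simp

open Polynomial in
/-- An exponential polynomial `∑ q a c * k ^ a * x c ^ k` with distinct nonzero `x c` which
vanishes at as many consecutive integers as it has coefficients is identically zero. -/
theorem expPoly_coeff_eq_zero {F : Type*} [Field F] [CharZero F] {n L : ℕ} (x : Fin L → F)
    (hx : Function.Injective x) (hx0 : ∀ c, x c ≠ 0) (q : Fin n → Fin L → F)
    (h : ∀ k < n * L, ∑ a, ∑ c, q a c * ((k : F) ^ (a : ℕ) * x c ^ k) = 0) :
    ∀ a c, q a c = 0 := by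
  classical
  have key : ∀ P : F[X], P.degree < (n * L : ℕ) →
      ∑ a, ∑ c, q a c * (eulerOp^[(a : ℕ)] P).eval (x c) = 0 := by
    intro P hP
    have : ∀ a : Fin n, ∀ c, q a c * (eulerOp^[(a : ℕ)] P).eval (x c) =
        ∑ k ∈ Finset.range (n * L), P.coeff k * (q a c * ((k : F) ^ (a : ℕ) * x c ^ k)) := by
      intro a c
      rw [eval_eulerOp_iterate P a _ hP, Finset.mul_sum]
      exact Finset.sum_congr rfl fun k _ => by ring
    simp_rw [this]
    rw [Finset.sum_congr rfl fun a _ => Finset.sum_comm, Finset.sum_comm]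
    refine Finset.sum_eq_zero fun k hk => ?_
    simp_rw [← Finset.mul_sum]
    rw [h k (Finset.mem_range.1 hk), mul_zero]
  by_contra! hne
  obtain ⟨a₀, c, hac⟩ := hne
  obtain ⟨m, hm, hmax⟩ := Finset.exists_max_image
    (Finset.univ.filter fun a => q a c ≠ 0) id ⟨a₀, by simpa using hac⟩
  simp only [Finset.mem_filter, Finset.mem_univ, true_and, id] at hm hmax
  set R : F[X] := ∏ d ∈ Finset.univ.erase c, (X - C (x d)) ^ n with hR
  have hRm : R.Monic := monic_prod_of_monic _ _ fun d _ => (monic_X_sub_C _).pow n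
  have hdeg : ((X - C (x c)) ^ (m : ℕ) * R).degree < ((n * L : ℕ) : WithBot ℕ) := by
    have hM : ((X - C (x c)) ^ (m : ℕ)).Monic := (monic_X_sub_C _).pow _
    rw [degree_eq_natDegree (hM.mul hRm).ne_zero, hM.natDegree_mul hRm, hR,
      natDegree_prod_of_monic _ _ fun d _ => (monic_X_sub_C _).pow n]
    simp only [natDegree_pow, natDegree_X_sub_C, Finset.sum_const, Finset.card_erase_of_mem,
      Finset.mem_univ, Finset.card_univ, Fintype.card_fin, smul_eq_mul]
    have hL : 0 < L := c.pos
    obtain ⟨L', rfl⟩ := Nat.exists_eq_succ_of_ne_zero hL.ne'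
    have hmn := m.2
    norm_cast
    simp only [Nat.succ_sub_one, mul_one, Nat.succ_eq_add_one]
    nlinarith
  have hz := key _ hdeg
  rw [Finset.sum_eq_single m, Finset.sum_eq_single c] at hz
  · rw [eval_eulerOp_iterate_X_sub_C_pow_mul] at hz
    have hRe : R.eval (x c) ≠ 0 := by
      rw [hR, eval_prod, Finset.prod_ne_zero_iff]
      intro d hd
      simp only [eval_pow, eval_sub, eval_X, eval_C]
      exact pow_ne_zero _ (sub_ne_zero.2 fun e => (Finset.ne_of_mem_erase hd) (hx e).symm)
    have := Nat.cast_ne_zero (R := F).2 (Nat.factorial_ne_zero (m : ℕ))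
    simp_all
  · intro d _ hd
    rw [eval_eulerOp_iterate_eq_zero (x d) m n m.2, mul_zero]
    exact Dvd.dvd.mul_left (Finset.dvd_prod_of_mem _ (by simp [hd])) _
  · simp
  · intro a _ ha
    refine Finset.sum_eq_zero fun d _ => ?_
    by_cases hd : d = c
    · subst hd
      by_cases hq : q a d = 0
      · rw [hq, zero_mul]
      · rw [eval_eulerOp_iterate_eq_zero (x d) a m (lt_of_le_of_ne (hmax a hq) ?_) _
          (Dvd.intro _ rfl), mul_zero]
        exact fun e => ha (Fin.ext e)
    · rw [eval_eulerOp_iterate_eq_zero (x d) a n a.2, mul_zero]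
      exact Dvd.dvd.mul_left (Finset.dvd_prod_of_mem _ (by simp [hd])) _
  · simp

/-- The values of `(d/dz + γ)^t z^a`, through their recursion in `t`. -/
def appell {R : Type*} [CommRing R] (γ z : R) : ℕ → ℕ → R
  | 0, a => z ^ a
  | t + 1, a => a * appell γ z t (a - 1) + γ * appell γ z t a

theorem map_appell {R R' : Type*} [CommRing R] [CommRing R'] (φ : R →+* R') (γ z : R)
    (t a : ℕ) : φ (appell γ z t a) = appell (φ γ) (φ z) t a := by
  induction t generalizing a with
  | zero => simp [appell]
  | succ t ih => simp [appell, ih]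

theorem appell_le {R : Type*} [CommRing R] (N : R → ℝ) (hN : ∀ x, 0 ≤ N x)
    (hadd : ∀ x y, N (x + y) ≤ N x + N y) (hmul : ∀ x y, N (x * y) ≤ N x * N y)
    (hnat : ∀ n : ℕ, N n ≤ n) (γ z : R) (r g : ℝ) (hr : 1 ≤ r) (hz : ∀ n : ℕ, N (z ^ n) ≤ r ^ n)
    (hg : N γ ≤ g) (t a : ℕ) :
    N (appell γ z t a) ≤ r ^ a * (a + g) ^ t := by
  have hg0 : 0 ≤ g := (hN γ).trans hg
  induction t generalizing a with
  | zero => simpa [appell] using hz a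
  | succ t ih =>
    have h1 : N (appell γ z t (a - 1)) ≤ r ^ a * (a + g) ^ t := by
      refine (ih (a - 1)).trans ?_
      have : ((a - 1 : ℕ) : ℝ) ≤ a := by exact_mod_cast Nat.sub_le a 1
      gcongr
      exact Nat.sub_le a 1
    calc N (appell γ z (t + 1) a)
        ≤ N ((a : R) * appell γ z t (a - 1)) + N (γ * appell γ z t a) := hadd _ _
      _ ≤ N (a : R) * N (appell γ z t (a - 1)) + N γ * N (appell γ z t a) :=
          add_le_add (hmul _ _) (hmul _ _)
      _ ≤ a * (r ^ a * (a + g) ^ t) + g * (r ^ a * (a + g) ^ t) := by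
          have := hnat a
          have := ih a
          gcongr
          · exact hN _
          · exact hN _
      _ = r ^ a * (a + g) ^ (t + 1) := by ring

theorem hasDerivAt_appell (γ z : ℂ) (t a : ℕ) :
    HasDerivAt (fun z => appell γ z t a) (a * appell γ z t (a - 1)) z := by
  induction t generalizing a with
  | zero => simpa [appell] using hasDerivAt_pow a z
  | succ t ih =>
    have := ((ih (a - 1)).const_mul (a : ℂ)).fun_add ((ih a).const_mul γ)
    simp only [appell]
    refine this.congr_deriv ?_
    ring

/-- The auxiliary function of Baker's method: the mixed derivative of order `(s, t)` of
`∑ p a b c * z₀ ^ a * exp (b z₁) * exp (c (β₀ z₀ + β₁ z₁))` on the line `z₁ = ω z₀`. -/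
def auxFun {m n : ℕ} (ω β₀ β₁ : ℂ) (p : Fin m × Fin n × Fin n → ℂ) (s t : ℕ) (z : ℂ) : ℂ :=
  ∑ i, p i * (appell ((i.2.2 : ℕ) * β₀) z s i.1 * ((i.2.1 : ℕ) + (i.2.2 : ℕ) * β₁) ^ t *
    Complex.exp (((i.2.1 : ℕ) * ω + (i.2.2 : ℕ) * (β₀ + β₁ * ω)) * z))

theorem hasDerivAt_auxFun {m n : ℕ} (ω β₀ β₁ : ℂ) (p : Fin m × Fin n × Fin n → ℂ) (s t : ℕ)
    (z : ℂ) :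
    HasDerivAt (auxFun ω β₀ β₁ p s t)
      (auxFun ω β₀ β₁ p (s + 1) t z + ω * auxFun ω β₀ β₁ p s (t + 1) z) z := by
  unfold auxFun
  rw [Finset.mul_sum, ← Finset.sum_add_distrib]
  refine HasDerivAt.fun_sum fun i _ => ?_
  have he : HasDerivAt (fun z => Complex.exp (((i.2.1 : ℕ) * ω + (i.2.2 : ℕ) * (β₀ + β₁ * ω)) * z))
      (Complex.exp (((i.2.1 : ℕ) * ω + (i.2.2 : ℕ) * (β₀ + β₁ * ω)) * z) *
        (((i.2.1 : ℕ) * ω + (i.2.2 : ℕ) * (β₀ + β₁ * ω)) * 1)) z :=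
    ((hasDerivAt_id z).const_mul _).cexp
  have := (((hasDerivAt_appell ((i.2.2 : ℕ) * β₀) z s i.1).mul_const
    ((((i.2.1 : ℕ) : ℂ) + (i.2.2 : ℕ) * β₁) ^ t)).fun_mul he).const_mul (p i)
  refine this.congr_deriv ?_
  simp only [appell]
  ring

theorem differentiable_auxFun {m n : ℕ} (ω β₀ β₁ : ℂ) (p : Fin m × Fin n × Fin n → ℂ)
    (s t : ℕ) : Differentiable ℂ (auxFun ω β₀ β₁ p s t) :=
  fun z => (hasDerivAt_auxFun ω β₀ β₁ p s t z).differentiableAt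

theorem iteratedDeriv_auxFun_eq_zero {m n : ℕ} (ω β₀ β₁ : ℂ) (p : Fin m × Fin n × Fin n → ℂ)
    (T : ℕ) (z : ℂ) (h : ∀ s < T, ∀ t < T, auxFun ω β₀ β₁ p s t z = 0) (r s t : ℕ)
    (hs : s + r < T) (ht : t + r < T) : iteratedDeriv r (auxFun ω β₀ β₁ p s t) z = 0 := by
  induction r generalizing s t with
  | zero => simpa using h s hs t ht
  | succ r ih =>
    have hd : deriv (auxFun ω β₀ β₁ p s t) =
        fun z => auxFun ω β₀ β₁ p (s + 1) t z + ω * auxFun ω β₀ β₁ p s (t + 1) z :=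
      funext fun z => (hasDerivAt_auxFun ω β₀ β₁ p s t z).deriv
    have hc : ∀ s t, ContDiffAt ℂ r (auxFun ω β₀ β₁ p s t) z := fun s t =>
      (differentiable_auxFun ω β₀ β₁ p s t).contDiff.contDiffAt
    rw [iteratedDeriv_succ', hd, iteratedDeriv_fun_add (hc _ _) (contDiffAt_const.mul (hc _ _)),
      iteratedDeriv_const_mul_field, ih _ _ (by omega) (by omega), ih _ _ (by omega) (by omega)]
    simp

theorem norm_auxFun_le {m n : ℕ} (ω β₀ β₁ : ℂ) (p : Fin m × Fin n × Fin n → ℂ) (P h r : ℝ)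
    (hp : ∀ i, ‖p i‖ ≤ P) (h1 : 1 ≤ h) (hβ₀ : ‖β₀‖ ≤ h) (hβ₁ : ‖β₁‖ ≤ h) (hr : 1 ≤ r)
    (s t : ℕ) (z : ℂ) (hz : ‖z‖ ≤ r) :
    ‖auxFun ω β₀ β₁ p s t z‖ ≤ (m * (n * n) : ℕ) * (P * (r ^ m * (m + n * h) ^ s *
      (n + n * h) ^ t * Real.exp (n * (‖ω‖ + ‖β₀ + β₁ * ω‖) * r))) := by
  have hP : ∀ i : Fin m × Fin n × Fin n, 0 ≤ P := fun i => (norm_nonneg _).trans (hp i)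
  unfold auxFun
  refine (norm_sum_le _ _).trans ?_
  refine (Finset.sum_le_card_nsmul _ _ (P * (r ^ m * (m + n * h) ^ s *
      (n + n * h) ^ t * Real.exp (n * (‖ω‖ + ‖β₀ + β₁ * ω‖) * r))) fun i _ => ?_).trans ?_
  · obtain ⟨a, b, c⟩ := i
    have ha : ((a : ℕ) : ℝ) ≤ m := by exact_mod_cast a.2.le
    have hb : ((b : ℕ) : ℝ) ≤ n := by exact_mod_cast b.2.le
    have hc : ((c : ℕ) : ℝ) ≤ n := by exact_mod_cast c.2.le
    have e1 : ‖appell ((c : ℕ) * β₀) z s a‖ ≤ r ^ m * (m + n * h) ^ s := by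
      refine (appell_le (fun z : ℂ => ‖z‖) (fun _ => norm_nonneg _) norm_add_le
        (fun x y => (norm_mul x y).le) (fun k => (Complex.norm_natCast k).le) _ z r (n * h) hr
        (fun k => ?_) ?_ s a).trans ?_
      · rw [norm_pow]
        gcongr
      · rw [norm_mul, Complex.norm_natCast]
        gcongr
      · gcongr
        exact a.2.le
    have e2 : ‖(((b : ℕ) : ℂ) + (c : ℕ) * β₁) ^ t‖ ≤ (n + n * h) ^ t := by
      rw [norm_pow]
      gcongr
      refine (norm_add_le _ _).trans ?_
      rw [norm_mul, Complex.norm_natCast, Complex.norm_natCast]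
      gcongr
    have e3 : ‖Complex.exp (((b : ℕ) * ω + (c : ℕ) * (β₀ + β₁ * ω)) * z)‖ ≤
        Real.exp (n * (‖ω‖ + ‖β₀ + β₁ * ω‖) * r) := by
      refine (Complex.norm_exp_le_exp_norm _).trans (Real.exp_le_exp.2 ?_)
      rw [norm_mul]
      gcongr
      refine (norm_add_le _ _).trans ?_
      rw [norm_mul, norm_mul, Complex.norm_natCast, Complex.norm_natCast, mul_add]
      gcongr
    have := hP (a, b, c)
    rw [norm_mul, norm_mul, norm_mul]
    have := hp (a, b, c)
    gcongr
  · simp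

open NumberField in
/-- Siegel's lemma over the ring of integers, with at least twice as many unknowns as equations. -/
theorem exists_siegel_const (K : Type*) [Field K] [NumberField K] :
    ∃ C : ℝ, 1 ≤ C ∧ ∀ (α β : Type) [Fintype α] [Fintype β] (M : Matrix α β (𝓞 K)) (A : ℝ),
      0 < Fintype.card α → 2 * Fintype.card α ≤ Fintype.card β → 1 ≤ A →
      (∀ k l, house (M k l : K) ≤ A) →
      ∃ x : β → 𝓞 K, x ≠ 0 ∧ M.mulVec x = 0 ∧
        ∀ l, house (x l : K) ≤ C * (Fintype.card β * A) := by
  classical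
  obtain ⟨c, hc⟩ : ∃ c : ℝ, ∀ (α β : Type) [Fintype α] [Fintype β] (M : Matrix α β (𝓞 K))
      (A : ℝ), M ≠ 0 → 0 < Fintype.card α → Fintype.card α < Fintype.card β →
      (∀ k l, house (M k l : K) ≤ A) →
      ∃ x : β → 𝓞 K, x ≠ 0 ∧ M.mulVec x = 0 ∧
        ∀ l, house (x l : K) ≤ c * ((c * Fintype.card β * A) ^
          ((Fintype.card α : ℝ) / (Fintype.card β - Fintype.card α))) :=
    ⟨_, fun α β _ _ M A hM h0 hlt hA =>
      house.exists_ne_zero_int_vec_house_le K M hM h0 hlt rfl hA rfl⟩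
  refine ⟨(|c| + 1) ^ 2, by nlinarith [abs_nonneg c], ?_⟩
  intro α β _ _ M A h0 h2 hA hMA
  have hb : (1 : ℝ) ≤ Fintype.card β := by exact_mod_cast (by omega : 1 ≤ Fintype.card β)
  have hbA : 1 ≤ Fintype.card β * A := one_le_mul_of_one_le_of_one_le hb hA
  by_cases hM : M = 0
  · have : Nonempty β := Fintype.card_pos_iff.1 (by omega)
    refine ⟨fun _ => 1, ?_, by simp [hM], fun l => ?_⟩
    · intro h
      exact one_ne_zero (congrFun h (Classical.arbitrary β))
    · have : house ((1 : 𝓞 K) : K) = 1 := by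
        have := house_intCast (K := K) 1
        simpa using this
      rw [this]
      exact one_le_mul_of_one_le_of_one_le (by nlinarith [abs_nonneg c]) hbA
  obtain ⟨x, hx0, hx, hxl⟩ := hc α β M A hM h0 (by omega) hMA
  refine ⟨x, hx0, hx, fun l => (hxl l).trans ?_⟩
  set e : ℝ := (Fintype.card α : ℝ) / (Fintype.card β - Fintype.card α)
  have h0' : (0 : ℝ) < Fintype.card α := by exact_mod_cast h0
  have h2' : 2 * (Fintype.card α : ℝ) ≤ Fintype.card β := by exact_mod_cast h2
  have he0 : 0 ≤ e := div_nonneg h0'.le (by linarith)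
  have he1 : e ≤ 1 := by
    rw [div_le_one (by linarith)]
    linarith
  have hle : |(c * Fintype.card β * A) ^ e| ≤ (|c| + 1) * (Fintype.card β * A) := by
    have hbig : |c * Fintype.card β * A| ≤ (|c| + 1) * (Fintype.card β * A) := by
      rw [abs_mul, abs_mul, abs_of_nonneg (by linarith : 0 ≤ A), Nat.abs_cast, mul_assoc]
      gcongr
      linarith
    have h1 : 1 ≤ (|c| + 1) * (Fintype.card β * A) :=
      one_le_mul_of_one_le_of_one_le (by linarith [abs_nonneg c]) hbA
    calc |(c * Fintype.card β * A) ^ e| ≤ |c * Fintype.card β * A| ^ e :=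
          Real.abs_rpow_le_abs_rpow _ _
      _ ≤ ((|c| + 1) * (Fintype.card β * A)) ^ e := by gcongr
      _ ≤ ((|c| + 1) * (Fintype.card β * A)) ^ (1 : ℝ) :=
          Real.rpow_le_rpow_of_exponent_le h1 he1
      _ = _ := Real.rpow_one _
  calc c * (c * Fintype.card β * A) ^ e ≤ |c * (c * Fintype.card β * A) ^ e| := le_abs_self _
    _ = |c| * |(c * Fintype.card β * A) ^ e| := abs_mul _ _
    _ ≤ (|c| + 1) * ((|c| + 1) * (Fintype.card β * A)) := by
        gcongr
        linarith
    _ = _ := by ring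

open NumberField in
/-- Liouville's inequality for algebraic integers. -/
theorem one_le_norm_mul_house_pow {K : Type*} [Field K] [NumberField K] (σ : K →+* ℂ)
    (g : 𝓞 K) (hg : g ≠ 0) : 1 ≤ ‖σ g‖ * house (g : K) ^ (Module.finrank ℚ K - 1) := by
  refine le_trans ?_ (norm_norm_le_norm_mul_house_pow (g : K) σ)
  rw [← Algebra.coe_norm_int]
  have : Algebra.norm ℤ g ≠ 0 := Algebra.norm_ne_zero_iff.2 hg
  have h1 : 1 ≤ |Algebra.norm ℤ g| := Int.one_le_abs this
  have h2 : ‖((Algebra.norm ℤ g : ℤ) : ℚ)‖ = ((|Algebra.norm ℤ g| : ℤ) : ℝ) := by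
    rw [← Rat.norm_cast_real]
    simp
  rw [h2]
  exact_mod_cast h1

open NumberField in
/-- The coefficients of the linear system of Baker's method. -/
def auxCoeff {K : Type*} [Field K] [NumberField K] {m n : ℕ} (b₀ b₁ a : 𝓞 K) (s t k : ℕ)
    (i : Fin m × Fin n × Fin n) : 𝓞 K :=
  appell ((i.2.2 : ℕ) * b₀) (k : 𝓞 K) s i.1 * ((i.2.1 : ℕ) + (i.2.2 : ℕ) * b₁) ^ t *
    a ^ ((i.2.2 : ℕ) * k)

open NumberField in
theorem house_natCast_le {K : Type*} [Field K] [NumberField K] (k : ℕ) :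
    house (k : K) ≤ k := by
  simpa using (house_intCast (K := K) (k : ℤ)).le

open NumberField in
theorem house_auxCoeff_le {K : Type*} [Field K] [NumberField K] {m n : ℕ} (b₀ b₁ a : 𝓞 K)
    (h r : ℝ) (h1 : 1 ≤ h) (hb₀ : house (b₀ : K) ≤ h) (hb₁ : house (b₁ : K) ≤ h)
    (ha : house (a : K) ≤ h) (hr : 1 ≤ r) (s t k : ℕ) (hk : (k : ℝ) ≤ r)
    (i : Fin m × Fin n × Fin n) :
    house ((auxCoeff b₀ b₁ a s t k i : 𝓞 K) : K) ≤
      r ^ m * (m + n * h) ^ s * (n + n * h) ^ t * h ^ (n * k) := by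
  obtain ⟨i, j, c⟩ := i
  have hc : ((c : ℕ) : ℝ) ≤ n := by exact_mod_cast c.2.le
  have hj : ((j : ℕ) : ℝ) ≤ n := by exact_mod_cast j.2.le
  have hi : ((i : ℕ) : ℝ) ≤ m := by exact_mod_cast i.2.le
  have hpow : ∀ (x : K) (e : ℕ), house (x ^ e) ≤ house x ^ e := house_pow_le
  have e1 : house ((appell ((c : ℕ) * b₀) (k : 𝓞 K) s i : 𝓞 K) : K) ≤
      r ^ m * (m + n * h) ^ s := by
    refine (appell_le (fun x : 𝓞 K => house (x : K)) (fun _ => house_nonneg _)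
      (fun x y => house_add_le (x : K) y) (fun x y => house_mul_le (x : K) y)
      (fun e => house_natCast_le e) _ _ r (n * h) hr (fun e => ?_) ?_ s i).trans ?_
    · refine (hpow (k : K) e).trans ?_
      have := house_natCast_le (K := K) k
      have := house_nonneg (k : K)
      gcongr
      linarith
    · refine (house_mul_le ((c : ℕ) : K) (b₀ : K)).trans ?_
      have := house_natCast_le (K := K) c
      have := house_nonneg (b₀ : K)
      gcongr
      linarith
    · gcongr
      exact i.2.le
  have e2 : house ((((((j : ℕ) : 𝓞 K) + (c : ℕ) * b₁) ^ t : 𝓞 K)) : K) ≤ (n + n * h) ^ t := by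
    refine (hpow (((j : ℕ) : K) + (c : ℕ) * (b₁ : K)) t).trans ?_
    have := house_natCast_le (K := K) j
    have := house_natCast_le (K := K) c
    have := house_nonneg (b₁ : K)
    have := house_mul_le ((c : ℕ) : K) (b₁ : K)
    have := house_add_le ((j : ℕ) : K) ((c : ℕ) * (b₁ : K))
    have : house ((c : ℕ) : K) * house (b₁ : K) ≤ n * h := by gcongr; linarith
    refine pow_le_pow_left₀ (house_nonneg _) ?_ t
    linarith
  have e3 : house ((a ^ ((c : ℕ) * k) : 𝓞 K) : K) ≤ h ^ (n * k) := by
    refine (hpow (a : K) _).trans ?_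
    calc house (a : K) ^ ((c : ℕ) * k) ≤ h ^ ((c : ℕ) * k) := by
          have := house_nonneg (a : K)
          gcongr
      _ ≤ h ^ (n * k) := by
          gcongr
          exact c.2.le
  have key : ∀ (A B C : 𝓞 K) (x y z : ℝ), 0 ≤ x → 0 ≤ y → house (A : K) ≤ x →
      house (B : K) ≤ y → house (C : K) ≤ z → house ((A * B * C : 𝓞 K) : K) ≤ x * y * z := by
    intro A B C x y z hx hy hA hB hC
    change house ((A : K) * B * C) ≤ _
    refine (house_mul_le _ _).trans (mul_le_mul ?_ hC (house_nonneg _) (mul_nonneg hx hy))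
    exact (house_mul_le _ _).trans (mul_le_mul hA hB (house_nonneg _) hx)
  exact key _ _ _ _ _ _ (by positivity) (by positivity) e1 e2 e3

open NumberField in
theorem map_sum_auxCoeff {K : Type*} [Field K] [NumberField K] {m n : ℕ} (σ : K →+* ℂ)
    (b₀ b₁ a : 𝓞 K)
    (hexp : σ a = Complex.exp (σ b₀ + σ b₁ * (2 * Real.pi * Complex.I)))
    (p : Fin m × Fin n × Fin n → 𝓞 K) (s t k : ℕ) :
    σ ((∑ i, auxCoeff b₀ b₁ a s t k i * p i : 𝓞 K) : K) =
      auxFun (2 * Real.pi * Complex.I) (σ b₀) (σ b₁) (fun i => σ (p i)) s t k := by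
  let φ : 𝓞 K →+* ℂ := σ.comp (algebraMap (𝓞 K) K)
  have hφ : ∀ x : 𝓞 K, σ (x : K) = φ x := fun _ => rfl
  simp only [hφ] at hexp ⊢
  rw [map_sum]
  unfold auxFun auxCoeff
  refine Finset.sum_congr rfl fun i _ => ?_
  have he : Complex.exp (((i.2.1 : ℕ) * (2 * Real.pi * Complex.I) +
      (i.2.2 : ℕ) * (φ b₀ + φ b₁ * (2 * Real.pi * Complex.I))) * k) =
      φ a ^ ((i.2.2 : ℕ) * k) := by
    rw [hexp, ← Complex.exp_nat_mul]
    have : ((i.2.1 : ℕ) * (2 * Real.pi * Complex.I) +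
        (i.2.2 : ℕ) * (φ b₀ + φ b₁ * (2 * Real.pi * Complex.I))) * k =
        ((i.2.2 : ℕ) * k : ℕ) * (φ b₀ + φ b₁ * (2 * Real.pi * Complex.I)) +
          ((i.2.1 : ℕ) * k : ℕ) * (2 * Real.pi * Complex.I) := by
      push_cast
      ring
    rw [this, Complex.exp_add, Complex.exp_nat_mul_two_pi_mul_I, mul_one]
  rw [he]
  simp only [map_mul, map_pow, map_add, map_natCast, map_appell]
  ring

theorem Differentiable.exists_eq_pow_mul {f : ℂ → ℂ} (hf : Differentiable ℂ f) (w : ℂ) (n : ℕ)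
    (h : (n : ℕ∞) ≤ analyticOrderAt f w) :
    ∃ g : ℂ → ℂ, Differentiable ℂ g ∧ ∀ z, f z = (z - w) ^ n * g z := by
  induction n generalizing f with
  | zero => exact ⟨f, hf, by simp⟩
  | succ n ih =>
    have hfw : f w = 0 := by
      refine apply_eq_zero_of_analyticOrderAt_ne_zero fun h0 => ?_
      rw [h0] at h
      simp at h
    have hd : Differentiable ℂ (dslope f w) := by
      have := (Complex.differentiableOn_dslope (c := w) (f := f) Filter.univ_mem).2
        hf.differentiableOn
      exact differentiableOn_univ.1 this
    have hfd : ∀ z, f z = (z - w) * dslope f w z := by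
      intro z
      have := sub_smul_dslope f w z
      rw [hfw, sub_zero, smul_eq_mul] at this
      exact this.symm
    have hord : analyticOrderAt f w = 1 + analyticOrderAt (dslope f w) w := by
      have : f = (fun z => z - w) * dslope f w := funext hfd
      conv_lhs => rw [this]
      rw [analyticOrderAt_mul (by fun_prop) (hd.analyticAt w)]
      congr 1
      simp
    obtain ⟨g, hg, hgd⟩ := ih hd (by
      rw [hord, Nat.cast_add, add_comm, Nat.cast_one] at h
      exact (ENat.add_le_add_iff_left (by simp)).1 h)
    exact ⟨g, hg, fun z => by rw [hfd, hgd]; ring⟩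

theorem Differentiable.exists_eq_prod_pow_mul {f : ℂ → ℂ} (hf : Differentiable ℂ f)
    (Z : Finset ℂ) (n : ℕ) (h : ∀ w ∈ Z, (n : ℕ∞) ≤ analyticOrderAt f w) :
    ∃ g : ℂ → ℂ, Differentiable ℂ g ∧ ∀ z, f z = (∏ w ∈ Z, (z - w) ^ n) * g z := by
  classical
  induction Z using Finset.induction_on generalizing f with
  | empty => exact ⟨f, hf, by simp⟩
  | insert w Z hw ih =>
    obtain ⟨g, hg, hgd⟩ := hf.exists_eq_pow_mul w n (h w (by simp))
    obtain ⟨g', hg', hgd'⟩ := ih hg (by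
      intro v hv
      have hv' := h v (by simp [hv])
      have : f = (fun z => (z - w) ^ n) * g := funext hgd
      rw [this, analyticOrderAt_mul (by fun_prop) (hg.analyticAt v)] at hv'
      have h0 : analyticOrderAt (fun z => (z - w) ^ n) v = 0 := by
        rw [AnalyticAt.analyticOrderAt_eq_zero (by fun_prop)]
        exact pow_ne_zero _ (sub_ne_zero.2 fun e => hw (e ▸ hv))
      rwa [h0, zero_add] at hv')
    refine ⟨g', hg', fun z => ?_⟩
    rw [hgd, hgd', Finset.prod_insert hw]
    ring

/-- Schwarz lemma for an entire function vanishing to order `n` at `0, …, S - 1`. -/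
theorem norm_le_of_zeros_at_naturals {f : ℂ → ℂ} (hf : Differentiable ℂ f) (n S S' k : ℕ)
    (hSS' : S ≤ S') (hk : k < S') (h : ∀ j < S, ∀ i < n, iteratedDeriv i f (j : ℂ) = 0) (M : ℝ)
    (hM : ∀ z : ℂ, ‖z‖ = 4 * S' → ‖f z‖ ≤ M) :
    ‖f k‖ ≤ M / 3 ^ (n * S) := by
  classical
  have hS' : (0 : ℝ) < S' := by exact_mod_cast (by omega : 0 < S')
  obtain ⟨g, hg, hgd⟩ := hf.exists_eq_prod_pow_mul
    ((Finset.range S).image (fun j : ℕ => (j : ℂ))) n (by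
      simp only [Finset.mem_image, Finset.mem_range, forall_exists_index, and_imp]
      rintro w j hj rfl
      rw [natCast_le_analyticOrderAt_iff_iteratedDeriv_eq_zero (hf.analyticAt _)]
      exact h j hj)
  simp_rw [Finset.prod_image (s := Finset.range S) (g := fun j : ℕ => (j : ℂ))
    (fun a _ b _ e => Nat.cast_injective e)] at hgd
  have hM0 : 0 ≤ M := (norm_nonneg _).trans (hM (4 * S' : ℝ) (by simp))
  have hgM : ∀ z : ℂ, ‖z‖ ≤ 4 * S' → ‖g z‖ ≤ M / (3 * S') ^ (n * S) := by
    intro z hz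
    refine Complex.norm_le_of_forall_mem_frontier_norm_le (U := Metric.ball 0 (4 * S'))
      Metric.isBounded_ball hg.diffContOnCl ?_ ?_
    · intro w hw
      rw [frontier_ball _ (by positivity), mem_sphere_zero_iff_norm] at hw
      rw [le_div_iff₀ (by positivity)]
      refine le_trans ?_ (hM w hw)
      rw [hgd, norm_mul, mul_comm]
      gcongr
      rw [norm_prod, pow_mul]
      calc ((3 * S' : ℝ) ^ n) ^ S = ∏ j ∈ Finset.range S, (3 * S' : ℝ) ^ n := by simp
        _ ≤ _ := by
          refine Finset.prod_le_prod (fun _ _ => by positivity) fun j hj => ?_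
          rw [norm_pow]
          gcongr
          have h1 := norm_sub_norm_le w (j : ℂ)
          have h2 : (j : ℝ) ≤ S' := by
            have := Finset.mem_range.1 hj
            exact_mod_cast (by omega : j ≤ S')
          rw [Complex.norm_natCast, hw] at h1
          linarith
    · rw [closure_ball _ (by positivity)]
      simpa using hz
  have hk' : (k : ℝ) ≤ S' := by exact_mod_cast hk.le
  have h1 := hgM k (by rw [Complex.norm_natCast]; linarith)
  rw [hgd, norm_mul, norm_prod]
  have h2 : ∏ j ∈ Finset.range S, ‖((k : ℂ) - j) ^ n‖ ≤ ((S' : ℝ) ^ n) ^ S := by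
    calc _ ≤ ∏ j ∈ Finset.range S, (S' : ℝ) ^ n := by
          refine Finset.prod_le_prod (fun _ _ => by positivity) fun j hj => ?_
          rw [norm_pow]
          gcongr
          have h2 : j < S' := by
            have := Finset.mem_range.1 hj
            omega
          have : ((k : ℂ) - j) = (((k : ℤ) - j : ℤ) : ℂ) := by push_cast; ring
          rw [this, Complex.norm_intCast]
          have : |((k : ℤ) - j)| ≤ S' := by rw [abs_le]; omega
          exact_mod_cast this
      _ = _ := by simp
  calc _ ≤ ((S' : ℝ) ^ n) ^ S * (M / (3 * S') ^ (n * S)) := by gcongr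
    _ = _ := by
      rw [← pow_mul, mul_pow]
      field_simp

theorem natCast_rpow_bound {X : ℕ} (hX : 2 ≤ X) {h r : ℝ} (h0 : 0 ≤ h) (hXh : h + 1 ≤ X)
    (hr : 0 ≤ r) (hrX : r ≤ (X : ℝ) ^ 17) (s t : ℕ) (hs : s ≤ 6 * X ^ 10) (ht : t ≤ 6 * X ^ 10) :
    r ^ (X ^ 10) * (((X ^ 10 : ℕ) : ℝ) + (X ^ 6 : ℕ) * h) ^ s *
      (((X ^ 6 : ℕ) : ℝ) + (X ^ 6 : ℕ) * h) ^ t ≤ Real.exp (149 * X ^ 10 * Real.log X) := by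
  have hX2 : (2 : ℝ) ≤ X := by exact_mod_cast hX
  have hX1 : (1 : ℝ) ≤ X := by linarith
  have e1 : ((X ^ 10 : ℕ) : ℝ) + (X ^ 6 : ℕ) * h ≤ (X : ℝ) ^ 11 := by
    push_cast
    have : (X : ℝ) ^ 6 * h ≤ X ^ 6 * X ^ 4 := by
      gcongr
      have : (X : ℝ) ^ 1 ≤ X ^ 4 := pow_le_pow_right₀ hX1 (by norm_num)
      linarith
    nlinarith [pow_pos (by linarith : (0 : ℝ) < X) 10]
  have e2 : ((X ^ 6 : ℕ) : ℝ) + (X ^ 6 : ℕ) * h ≤ (X : ℝ) ^ 11 := by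
    refine le_trans ?_ e1
    gcongr
    · omega
    · norm_num
  have e3 : Real.exp (149 * X ^ 10 * Real.log X) = (X : ℝ) ^ (149 * X ^ 10) := by
    rw [← Real.rpow_natCast (X : ℝ) (149 * X ^ 10), Real.rpow_def_of_pos (by linarith)]
    push_cast
    ring_nf
  rw [e3]
  calc _ ≤ ((X : ℝ) ^ 17) ^ (X ^ 10) * ((X : ℝ) ^ 11) ^ s * ((X : ℝ) ^ 11) ^ t := by gcongr
    _ ≤ ((X : ℝ) ^ 17) ^ (X ^ 10) * ((X : ℝ) ^ 11) ^ (6 * X ^ 10) *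
        ((X : ℝ) ^ 11) ^ (6 * X ^ 10) := by
        have : (1 : ℝ) ≤ X ^ 11 := one_le_pow₀ hX1
        gcongr
    _ = _ := by
        rw [← pow_mul, ← pow_mul, ← pow_add, ← pow_add]
        ring_nf

open NumberField in
/-- The extrapolation step of Baker's method. -/
theorem extrapolation_step {K : Type*} [Field K] [NumberField K] (σ : K →+* ℂ)
    (b₀ b₁ a : 𝓞 K)
    (hexp : σ a = Complex.exp (σ b₀ + σ b₁ * (2 * Real.pi * Complex.I)))
    (h : ℝ) (h1 : 1 ≤ h) (hb₀ : house (b₀ : K) ≤ h) (hb₁ : house (b₁ : K) ≤ h)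
    (ha : house (a : K) ≤ h) (X : ℕ) (hX4 : 4 ≤ X) (hXh : h + 1 ≤ X)
    (hX : Module.finrank ℚ K * (343 * Real.log X + 2 * Real.log h +
      4 * (‖(2 * Real.pi * Complex.I : ℂ)‖ + ‖σ b₀ + σ b₁ * (2 * Real.pi * Complex.I)‖)) <
      X * Real.log 3)
    (p : Fin (X ^ 10) × Fin (X ^ 6) × Fin (X ^ 6) → 𝓞 K)
    (hp : ∀ i, house (p i : K) ≤ Real.exp (172 * X ^ 10 * Real.log X + X ^ 7 * Real.log h))
    (T j : ℕ) (hT : T ≤ 6 * X ^ 10) (hj : j < 5)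
    (hz : ∀ s < T, ∀ t < T, ∀ k < X ^ (1 + 3 * j), ∑ i, auxCoeff b₀ b₁ a s t k i * p i = 0)
    (s t k : ℕ) (hs : s + X ^ 10 ≤ T) (ht : t + X ^ 10 ≤ T) (hk : k < X ^ (1 + 3 * (j + 1))) :
    ∑ i, auxCoeff b₀ b₁ a s t k i * p i = 0 := by
  by_contra hne
  set ω : ℂ := 2 * Real.pi * Complex.I with hω
  set w : ℝ := ‖ω‖ + ‖σ b₀ + σ b₁ * ω‖ with hw
  set d := Module.finrank ℚ K with hd
  have hdpos : 0 < d := Module.finrank_pos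
  have hX4' : (4 : ℝ) ≤ X := by exact_mod_cast hX4
  have hX1 : (1 : ℝ) ≤ X := by linarith
  have hX0 : (0 : ℝ) < X := by linarith
  have hlX : 0 ≤ Real.log X := Real.log_nonneg hX1
  have hlh : 0 ≤ Real.log h := Real.log_nonneg h1
  have hw0 : 0 ≤ w := by positivity
  set W : ℝ := (X : ℝ) ^ (10 + 3 * j) with hW
  have hW10 : (X : ℝ) ^ 10 ≤ W := pow_le_pow_right₀ hX1 (by omega)
  have hW7 : (X : ℝ) ^ 7 ≤ W := pow_le_pow_right₀ hX1 (by omega)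
  have hW0 : 0 < W := by positivity
  set Q : ℝ := 343 * Real.log X + 2 * Real.log h + 4 * w with hQ
  set P : ℝ := Real.exp (172 * X ^ 10 * Real.log X + X ^ 7 * Real.log h) with hP
  have hcard : ((X ^ 10 * (X ^ 6 * X ^ 6) : ℕ) : ℝ) ≤ Real.exp (22 * X ^ 10 * Real.log X) := by
    have : Real.exp (22 * Real.log X) = (X : ℝ) ^ 22 := by
      rw [← Real.rpow_natCast, Real.rpow_def_of_pos hX0]
      push_cast
      ring_nf
    calc ((X ^ 10 * (X ^ 6 * X ^ 6) : ℕ) : ℝ) = (X : ℝ) ^ 22 := by push_cast; ring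
      _ = Real.exp (22 * Real.log X) := this.symm
      _ ≤ _ := by
        rw [Real.exp_le_exp]
        have : (1 : ℝ) ≤ X ^ 10 := one_le_pow₀ hX1
        nlinarith
  have hkr : (k : ℝ) ≤ (X : ℝ) ^ 17 := by
    have : k ≤ X ^ 17 := hk.le.trans (Nat.pow_le_pow_right (by omega) (by omega))
    exact_mod_cast this
  have hXk : ((X ^ 6 * k : ℕ) : ℝ) ≤ W := by
    have : X ^ 6 * k ≤ X ^ 6 * X ^ (1 + 3 * (j + 1)) := Nat.mul_le_mul_left _ hk.le
    rw [hW]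
    calc ((X ^ 6 * k : ℕ) : ℝ) ≤ ((X ^ 6 * X ^ (1 + 3 * (j + 1)) : ℕ) : ℝ) := by exact_mod_cast this
      _ = _ := by push_cast; ring
  have hT10 : 0 < X ^ 10 := by positivity
  -- size of the conjugates
  have hhouse : house ((∑ i, auxCoeff b₀ b₁ a s t k i * p i : 𝓞 K) : K) ≤ Real.exp (W * Q) := by
    have hsum : ((∑ i, auxCoeff b₀ b₁ a s t k i * p i : 𝓞 K) : K) =
        ∑ i, ((auxCoeff b₀ b₁ a s t k i : 𝓞 K) : K) * (p i : K) := by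
      exact map_sum (algebraMap (𝓞 K) K) _ _
    rw [hsum]
    refine (house_sum_le_sum_house _ _).trans ?_
    refine (Finset.sum_le_card_nsmul _ _ (Real.exp (149 * X ^ 10 * Real.log X) *
      Real.exp (W * Real.log h) * P) fun i _ => ?_).trans ?_
    · refine (house_mul_le _ _).trans (mul_le_mul ?_ (hp i) (house_nonneg _) (by positivity))
      refine (house_auxCoeff_le b₀ b₁ a h (X ^ 17) h1 hb₀ hb₁ ha (one_le_pow₀ hX1) s t k hkr
        i).trans ?_
      refine mul_le_mul (natCast_rpow_bound (by omega) (by linarith) hXh (by positivity) le_rfl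
        s t (by omega) (by omega)) ?_ (by positivity) (by positivity)
      rw [← Real.rpow_natCast, Real.rpow_def_of_pos (by linarith), Real.exp_le_exp, mul_comm]
      gcongr
    · simp only [Finset.card_univ, Fintype.card_prod, Fintype.card_fin, nsmul_eq_mul]
      calc _ ≤ Real.exp (22 * X ^ 10 * Real.log X) * (Real.exp (149 * X ^ 10 * Real.log X) *
            Real.exp (W * Real.log h) * P) := by gcongr
        _ = Real.exp (343 * (X ^ 10 * Real.log X) + (W * Real.log h + X ^ 7 * Real.log h)) := by
            rw [hP, ← Real.exp_add, ← Real.exp_add, ← Real.exp_add]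
            ring_nf
        _ ≤ Real.exp (W * Q) := by
            rw [Real.exp_le_exp, hQ]
            nlinarith [mul_le_mul_of_nonneg_right hW10 hlX, mul_le_mul_of_nonneg_right hW7 hlh,
              mul_nonneg hW0.le hw0]
  -- analytic upper bound
  have hval : ‖σ ((∑ i, auxCoeff b₀ b₁ a s t k i * p i : 𝓞 K) : K)‖ ≤
      Real.exp (W * Q) / 3 ^ (X ^ 10 * X ^ (1 + 3 * j)) := by
    rw [map_sum_auxCoeff σ b₀ b₁ a hexp p s t k]
    refine norm_le_of_zeros_at_naturals (differentiable_auxFun ω (σ b₀) (σ b₁) _ s t) (X ^ 10)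
      (X ^ (1 + 3 * j)) (X ^ (1 + 3 * (j + 1))) k (Nat.pow_le_pow_right (by omega) (by omega)) hk
      ?_ _ ?_
    · intro l hl i hi
      refine iteratedDeriv_auxFun_eq_zero ω (σ b₀) (σ b₁) _ T (l : ℂ) ?_ i s t (by omega) (by omega)
      intro s' hs' t' ht'
      rw [← map_sum_auxCoeff σ b₀ b₁ a hexp p s' t' l, hz s' hs' t' ht' l hl]
      simp
    · intro z hzn
      have hr17 : 4 * ((X ^ (1 + 3 * (j + 1)) : ℕ) : ℝ) ≤ (X : ℝ) ^ 17 := by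
        push_cast
        calc 4 * (X : ℝ) ^ (1 + 3 * (j + 1)) ≤ X * X ^ 16 := by
              gcongr
              omega
          _ = _ := by ring
      have hr1 : (1 : ℝ) ≤ 4 * ((X ^ (1 + 3 * (j + 1)) : ℕ) : ℝ) := by
        have : (1 : ℝ) ≤ (X : ℝ) ^ (1 + 3 * (j + 1)) := one_le_pow₀ hX1
        push_cast
        linarith
      refine (norm_auxFun_le ω (σ b₀) (σ b₁) _ P h _
        (fun i => (norm_embedding_le_house (p i : K) σ).trans (hp i)) h1
        ((norm_embedding_le_house _ σ).trans hb₀) ((norm_embedding_le_house _ σ).trans hb₁) hr1 s t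
        z hzn.le).trans ?_
      have hb := natCast_rpow_bound (by omega) (by linarith) hXh (by positivity) hr17
        s t (by omega) (by omega)
      have hexpw : ((X ^ 6 : ℕ) : ℝ) * w * (4 * ((X ^ (1 + 3 * (j + 1)) : ℕ) : ℝ)) = 4 * W * w := by
        rw [hW]
        push_cast
        ring
      rw [← hw, hexpw]
      calc _ ≤ Real.exp (22 * X ^ 10 * Real.log X) * (P * (Real.exp (149 * X ^ 10 * Real.log X) *
            Real.exp (4 * W * w))) := by gcongr
        _ = Real.exp (343 * (X ^ 10 * Real.log X) + X ^ 7 * Real.log h + 4 * (W * w)) := by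
            rw [hP, ← Real.exp_add, ← Real.exp_add, ← Real.exp_add]
            ring_nf
        _ ≤ Real.exp (W * Q) := by
            rw [Real.exp_le_exp, hQ]
            nlinarith [mul_le_mul_of_nonneg_right hW10 hlX, mul_le_mul_of_nonneg_right hW7 hlh,
              mul_nonneg hW0.le hlh]
  have h3 : (3 : ℝ) ^ (X ^ 10 * X ^ (1 + 3 * j)) = Real.exp (W * (X * Real.log 3)) := by
    rw [← Real.rpow_natCast, Real.rpow_def_of_pos (by norm_num), hW]
    push_cast
    ring_nf
  have hL := one_le_norm_mul_house_pow σ _ hne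
  rw [h3, ← Real.exp_sub] at hval
  have : (1 : ℝ) ≤ Real.exp (W * Q - W * (X * Real.log 3)) * Real.exp (W * Q) ^ (d - 1) :=
    hL.trans (mul_le_mul hval (pow_le_pow_left₀ (house_nonneg _) hhouse _)
      (pow_nonneg (house_nonneg _) _) (by positivity))
  rw [← Real.exp_nat_mul, ← Real.exp_add, Real.one_le_exp_iff, Nat.cast_sub hdpos] at this
  push_cast at this
  have : 0 ≤ W * (d * Q - X * Real.log 3) := by linarith
  nlinarith

theorem exists_large_natCast (d c M : ℝ) :
    ∃ X : ℕ, M ≤ X ∧ d * (343 * Real.log X + c) < X * Real.log 3 := by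
  have hlog3 : 0 < Real.log 3 := Real.log_pos (by norm_num)
  have h1 : Filter.Tendsto (fun x : ℝ => d * (343 * (Real.log x / x) + c / x)) Filter.atTop
      (nhds (d * (343 * 0 + 0))) := by
    have := Real.isLittleO_log_id_atTop.tendsto_div_nhds_zero
    exact ((this.const_mul 343).add (tendsto_const_nhds.div_atTop Filter.tendsto_id)).const_mul d
  have h2 := (h1.comp tendsto_natCast_atTop_atTop).eventually
    (gt_mem_nhds (by simpa using hlog3 : d * (343 * 0 + 0) < Real.log 3))
  obtain ⟨X, hX⟩ := ((h2.and (tendsto_natCast_atTop_atTop.eventually_ge_atTop M)).and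
    (Filter.eventually_gt_atTop 0)).exists
  obtain ⟨⟨hX1, hX2⟩, hX0⟩ := hX
  have hX0 : (0 : ℝ) < X := by exact_mod_cast hX0
  refine ⟨X, hX2, ?_⟩
  simp only [Function.comp] at hX1
  calc d * (343 * Real.log X + c) = X * (d * (343 * (Real.log X / X) + c / X)) := by
        field_simp
    _ < X * Real.log 3 := by gcongr

open NumberField in
/-- The zero estimate concluding Baker's method. -/
theorem eq_zero_of_sum_auxCoeff_eq_zero {K : Type*} [Field K] [NumberField K] (σ : K →+* ℂ)
    (b₀ b₁ a : 𝓞 K) (ha0 : (a : K) ≠ 0) (hna : ‖σ a‖ ≠ 1) {m n : ℕ}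
    (p : Fin m × Fin n × Fin n → 𝓞 K)
    (hz : ∀ t < n, ∀ k < m * n, ∑ i, auxCoeff b₀ b₁ a 0 t k i * p i = 0) : p = 0 := by
  have hinj : Function.Injective fun c : Fin n => (a : K) ^ (c : ℕ) := by
    intro c c' hcc
    have := congrArg (fun z => ‖σ z‖) hcc
    simp only [map_pow, norm_pow] at this
    have h0 : 0 < ‖σ a‖ := by simpa using ha0
    exact Fin.ext (pow_right_injective₀ h0 hna this)
  have hq : ∀ t < n, ∀ (e : Fin m) (c : Fin n),
      ∑ b : Fin n, (p (e, b, c) : K) * ((b : ℕ) + (c : ℕ) * (b₁ : K)) ^ t = 0 := by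
    intro t ht
    refine expPoly_coeff_eq_zero (fun c : Fin n => (a : K) ^ (c : ℕ)) hinj
      (fun c => pow_ne_zero _ ha0)
      (fun e c => ∑ b : Fin n, (p (e, b, c) : K) * ((b : ℕ) + (c : ℕ) * (b₁ : K)) ^ t) ?_
    intro k hk
    have h1 := congrArg (algebraMap (𝓞 K) K) (hz t ht k hk)
    rw [map_sum, map_zero, Fintype.sum_prod_type] at h1
    rw [← h1]
    refine Finset.sum_congr rfl fun e _ => ?_
    rw [Fintype.sum_prod_type_right]
    refine Finset.sum_congr rfl fun c _ => ?_
    rw [Finset.sum_mul]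
    refine Finset.sum_congr rfl fun b _ => ?_
    simp only [auxCoeff, appell, map_mul, map_pow, map_add, map_natCast, ← pow_mul]
    ring
  funext ⟨e, b, c⟩
  have hv : (fun b : Fin n => (p (e, b, c) : K)) = 0 := by
    refine Matrix.eq_zero_of_forall_pow_sum_mul_pow_eq_zero
      (f := fun b : Fin n => ((b : ℕ) + (c : ℕ) * (b₁ : K))) ?_ fun t => hq t t.2 e c
    intro b b' hbb
    simpa [Fin.ext_iff] using hbb
  have := congrFun hv b
  simpa using this

open NumberField in
/-- No nontrivial relation `log α = β₀ + β₁ · 2πi` with `α`, `β₀`, `β₁` algebraic integers. -/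
theorem norm_eq_one_of_eq_exp {K : Type*} [Field K] [NumberField K] (σ : K →+* ℂ)
    (b₀ b₁ a : 𝓞 K)
    (hexp : σ a = Complex.exp (σ b₀ + σ b₁ * (2 * Real.pi * Complex.I))) : ‖σ a‖ = 1 := by
  by_contra hna
  have ha0 : (a : K) ≠ 0 := by
    intro h
    rw [h, map_zero] at hexp
    exact Complex.exp_ne_zero _ hexp.symm
  obtain ⟨C, hC1, hC⟩ := exists_siegel_const K
  set h : ℝ := max 1 (max (house (b₀ : K)) (max (house (b₁ : K)) (house (a : K)))) with hh
  have h1 : 1 ≤ h := le_max_left _ _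
  have hb₀ : house (b₀ : K) ≤ h := by simp [hh]
  have hb₁ : house (b₁ : K) ≤ h := by simp [hh]
  have ha : house (a : K) ≤ h := by simp [hh]
  obtain ⟨X, hXM, hX⟩ := exists_large_natCast (Module.finrank ℚ K)
    (2 * Real.log h +
      4 * (‖(2 * Real.pi * Complex.I : ℂ)‖ + ‖σ b₀ + σ b₁ * (2 * Real.pi * Complex.I)‖))
    (max 72 (max (h + 1) C))
  rw [← add_assoc] at hX
  have hX72 : (72 : ℝ) ≤ X := (le_max_left _ _).trans hXM
  have hX72' : 72 ≤ X := by exact_mod_cast hX72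
  have hXh : h + 1 ≤ X := (le_max_left _ _).trans ((le_max_right _ _).trans hXM)
  have hXC : C ≤ X := (le_max_right _ _).trans ((le_max_right _ _).trans hXM)
  have hX0 : (0 : ℝ) < X := by linarith
  have hX1 : (1 : ℝ) ≤ X := by linarith
  have hlX : 0 ≤ Real.log X := Real.log_nonneg hX1
  have hlh : 0 ≤ Real.log h := Real.log_nonneg h1
  set A : ℝ := Real.exp (149 * X ^ 10 * Real.log X) * Real.exp (X ^ 7 * Real.log h) with hA
  obtain ⟨p, hp0, hpz, hpl⟩ := hC (Fin (6 * X ^ 10) × Fin (6 * X ^ 10) × Fin X)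
    (Fin (X ^ 10) × Fin (X ^ 6) × Fin (X ^ 6))
    (Matrix.of fun k i => auxCoeff b₀ b₁ a k.1 k.2.1 k.2.2 i) A
    (by simp only [Fintype.card_prod, Fintype.card_fin]; positivity)
    (by
      simp only [Fintype.card_prod, Fintype.card_fin]
      calc _ = 72 * X ^ 21 := by ring
        _ ≤ X * X ^ 21 := by gcongr
        _ = _ := by ring)
    (by
      rw [hA, ← Real.exp_add]
      exact Real.one_le_exp (by positivity))
    (by
      intro k i
      have hk : ((k.2.2 : ℕ) : ℝ) ≤ (X : ℝ) ^ 17 := by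
        have : (k.2.2 : ℕ) ≤ X ^ 17 := k.2.2.2.le.trans (Nat.le_self_pow (by norm_num) _)
        exact_mod_cast this
      refine (house_auxCoeff_le b₀ b₁ a h (X ^ 17) h1 hb₀ hb₁ ha (one_le_pow₀ hX1) k.1 k.2.1
        k.2.2 hk i).trans ?_
      refine mul_le_mul (natCast_rpow_bound (by omega) (by linarith) hXh (by positivity) le_rfl
        k.1 k.2.1 k.1.2.le k.2.1.2.le) ?_ (by positivity) (by positivity)
      rw [← Real.rpow_natCast, Real.rpow_def_of_pos (by linarith), Real.exp_le_exp, mul_comm]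
      gcongr
      push_cast
      have : ((k.2.2 : ℕ) : ℝ) ≤ X := by exact_mod_cast k.2.2.2.le
      calc (X : ℝ) ^ 6 * ((k.2.2 : ℕ) : ℝ) ≤ (X : ℝ) ^ 6 * X := by gcongr
        _ = (X : ℝ) ^ 7 := by ring)
  have hpb : ∀ i, house (p i : K) ≤ Real.exp (172 * X ^ 10 * Real.log X + X ^ 7 * Real.log h) := by
    intro i
    refine (hpl i).trans ?_
    simp only [Fintype.card_prod, Fintype.card_fin]
    have e23 : Real.exp (23 * Real.log X) = (X : ℝ) ^ 23 := by
      rw [← Real.rpow_natCast, Real.rpow_def_of_pos hX0]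
      push_cast
      ring_nf
    calc C * (((X ^ 10 * (X ^ 6 * X ^ 6) : ℕ) : ℝ) * A)
        ≤ X * (((X ^ 10 * (X ^ 6 * X ^ 6) : ℕ) : ℝ) * A) := by gcongr
      _ = X ^ 23 * A := by push_cast; ring
      _ = Real.exp (23 * Real.log X + (149 * X ^ 10 * Real.log X + X ^ 7 * Real.log h)) := by
          rw [hA, ← e23, ← Real.exp_add, ← Real.exp_add]
      _ ≤ _ := by
          rw [Real.exp_le_exp]
          have : (1 : ℝ) ≤ X ^ 10 := one_le_pow₀ hX1
          nlinarith
  have hvan : ∀ j ≤ 5, ∀ s < (6 - j) * X ^ 10, ∀ t < (6 - j) * X ^ 10, ∀ k < X ^ (1 + 3 * j),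
      ∑ i, auxCoeff b₀ b₁ a s t k i * p i = 0 := by
    intro j
    induction j with
    | zero =>
      intro _ s hs t ht k hk
      have := congrFun hpz (⟨s, by simpa using hs⟩, ⟨t, by simpa using ht⟩, ⟨k, by simpa using hk⟩)
      simpa [Matrix.mulVec, dotProduct] using this
    | succ j ih =>
      intro hj s hs t ht k hk
      have hsplit : (6 - j) * X ^ 10 = (6 - (j + 1)) * X ^ 10 + X ^ 10 := by
        rw [← Nat.succ_mul]
        congr 1
        omega
      exact extrapolation_step σ b₀ b₁ a hexp h h1 hb₀ hb₁ ha X (by omega) hXh hX p hpb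
        ((6 - j) * X ^ 10) j (Nat.mul_le_mul_right _ (by omega)) (by omega) (ih (by omega)) s t k
        (by omega) (by omega) hk
  refine hp0 (eq_zero_of_sum_auxCoeff_eq_zero σ b₀ b₁ a ha0 hna p fun t ht k hk => ?_)
  refine hvan 5 le_rfl 0 (by positivity) t (ht.trans_le ?_) k (hk.trans_eq (by ring))
  simpa using Nat.pow_le_pow_right (by omega) (by norm_num)

theorem isIntegral_pow_mul_aeval {A : Type*} [CommRing A] (D : ℤ) (x : A)
    (hx : IsIntegral ℤ ((D : A) * x)) (g : Polynomial ℤ) (e : ℕ) (he : g.natDegree ≤ e) :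
    IsIntegral ℤ ((D : A) ^ e * Polynomial.aeval x g) := by
  rw [Polynomial.aeval_eq_sum_range, Finset.mul_sum]
  refine IsIntegral.sum _ fun k hk => ?_
  have hke : k ≤ e := by
    rw [Finset.mem_range] at hk
    omega
  have : (D : A) ^ e * (g.coeff k • x ^ k) =
      (algebraMap ℤ A (g.coeff k * D ^ (e - k))) * ((D : A) * x) ^ k := by
    obtain ⟨l, rfl⟩ := Nat.exists_eq_add_of_le hke
    rw [Nat.add_sub_cancel_left]
    simp only [zsmul_eq_mul, algebraMap_int_eq, eq_intCast, Int.cast_mul, Int.cast_pow]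
    ring
  rw [this]
  exact isIntegral_algebraMap.mul (hx.pow k)

theorem exists_common_denominator {K : Type*} [Field K] [NumberField K] {ι : Type*}
    (s : Finset ι) (v : ι → K) :
    ∃ D : ℕ, 0 < D ∧ ∀ i ∈ s, IsIntegral ℤ ((D : K) * v i) := by
  classical
  induction s using Finset.induction_on with
  | empty => exact ⟨1, one_pos, by simp⟩
  | insert i s _ ih =>
    obtain ⟨D, hD, hs⟩ := ih
    obtain ⟨y, hy, hi⟩ := IsAlgebraic.exists_integral_multiple
      ((IsFractionRing.isAlgebraic_iff ℤ ℚ K).2 (Algebra.IsAlgebraic.isAlgebraic (R := ℚ) (v i)))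
    have hi' : IsIntegral ℤ (((y.natAbs : ℕ) : K) * v i) := by
      rw [zsmul_eq_mul] at hi
      rcases Int.natAbs_eq y with h | h
      · rw [h] at hi
        simpa using hi
      · rw [h] at hi
        simpa using hi.neg
    refine ⟨D * y.natAbs, by positivity, fun j hj => ?_⟩
    rw [Finset.mem_insert] at hj
    have h_integral : ∀ n : ℕ, IsIntegral ℤ (n : K) := fun n => isIntegral_natCast n
    push_cast
    rcases hj with rfl | hj
    · rw [mul_assoc]
      exact (h_integral D).mul hi'
    · rw [mul_comm (D : K), mul_assoc]
      exact (h_integral _).mul (hs j hj)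

theorem tendsto_pow_div_factorial_pred (A B : ℝ) :
    Filter.Tendsto (fun p : ℕ => A * (B ^ p / (p - 1).factorial)) Filter.atTop (nhds 0) := by
  rw [← Filter.tendsto_add_atTop_iff_nat 1]
  have := (FloorSemiring.tendsto_pow_div_factorial_atTop B).const_mul (A * B)
  simp only [mul_zero] at this
  refine this.congr fun p => ?_
  rw [Nat.add_sub_cancel, pow_succ]
  ring

/-- A sum of exponentials of a Galois-stable family of algebraic numbers containing zero does not
vanish. -/
theorem sum_exp_ne_zero {K : Type*} [Field K] [NumberField K] [IsGalois ℚ K] (σ : K →+* ℂ)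
    {ι : Type*} [Fintype ι] (v : ι → K) (i₀ : ι) (hi₀ : v i₀ = 0)
    (hG : ∀ τ : K ≃ₐ[ℚ] K, ∃ e : Equiv.Perm ι, ∀ i, τ (v i) = v (e i)) :
    ∑ i, Complex.exp (σ (v i)) ≠ 0 := by
  classical
  intro hsum
  set J := Finset.univ.filter fun i => v i ≠ 0 with hJ
  set m := (Finset.univ.filter fun i => v i = 0).card with hm
  have hmpos : 0 < m := Finset.card_pos.2 ⟨i₀, by simp [hi₀]⟩
  have hsum' : (m : ℂ) + ∑ i ∈ J, Complex.exp (σ (v i)) = 0 := by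
    rw [← Finset.sum_filter_add_sum_filter_not Finset.univ (fun i => v i = 0)] at hsum
    rw [← hsum, hm]
    congr 1
    rw [Finset.sum_congr rfl (g := fun _ => (1 : ℂ))]
    · simp
    · intro i hi
      simp [(Finset.mem_filter.1 hi).2]
  have hpoly : ∀ i, v i ≠ 0 → ∃ q : Polynomial ℤ, q.coeff 0 ≠ 0 ∧ Polynomial.aeval (v i) q = 0 :=
    fun i hi => IsAlgebraic.exists_nonzero_coeff_and_aeval_eq_zero
      ((IsFractionRing.isAlgebraic_iff ℤ ℚ K).2 (Algebra.IsAlgebraic.isAlgebraic (R := ℚ) (v i)))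
      (mem_nonZeroDivisors_of_ne_zero hi)
  choose! q hq0 hq using hpoly
  set f : Polynomial ℤ := ∏ i ∈ J, q i with hf
  have hf0 : f.eval 0 ≠ 0 := by
    rw [hf, Polynomial.eval_prod, Finset.prod_ne_zero_iff]
    intro i hi
    rw [← Polynomial.coeff_zero_eq_eval_zero]
    exact hq0 i (Finset.mem_filter.1 hi).2
  have haeval : ∀ (g : Polynomial ℤ) (x : K),
      Polynomial.aeval (σ x) g = σ (Polynomial.aeval x g) := fun g x =>
    Polynomial.aeval_algHom_apply σ.toIntAlgHom x g
  have hroot : ∀ i ∈ J, σ (v i) ∈ f.aroots ℂ := by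
    intro i hi
    rw [Polynomial.mem_aroots]
    refine ⟨fun h => hf0 (by simp [h]), ?_⟩
    rw [haeval, hf, map_prod, Finset.prod_eq_zero hi (hq i (Finset.mem_filter.1 hi).2), map_zero]
  obtain ⟨c, hc⟩ := LindemannWeierstrass.exp_polynomial_approx f hf0
  obtain ⟨D, hD, h_integral⟩ := exists_common_denominator J v
  set d := f.natDegree with hd
  have hev := (tendsto_pow_div_factorial_pred J.card (D ^ d * c)).eventually
    (gt_mem_nhds (by norm_num : (0 : ℝ) < 1))
  obtain ⟨M, hM⟩ := Filter.eventually_atTop.1 hev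
  obtain ⟨p, hpM, hp⟩ := Nat.exists_infinite_primes
    (max M (max ((f.eval 0).natAbs + 1) (max (m + 1) (D + 1))))
  simp only [max_le_iff] at hpM
  obtain ⟨hpM, hpf, hpm, hpD⟩ := hpM
  obtain ⟨n, hn, g, hgdeg, hg⟩ := hc p (by omega) hp
  have hfix : ∀ τ : K ≃ₐ[ℚ] K, τ (∑ i ∈ J, Polynomial.aeval (v i) g) =
      ∑ i ∈ J, Polynomial.aeval (v i) g := by
    intro τ
    obtain ⟨e, he⟩ := hG τ
    rw [hJ, Finset.sum_filter, map_sum,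
      ← Equiv.sum_comp e fun i => if v i ≠ 0 then Polynomial.aeval (v i) g else 0]
    refine Finset.sum_congr rfl fun i _ => ?_
    have h1 : v (e i) ≠ 0 ↔ v i ≠ 0 := by
      rw [← he]
      simp
    have h2 : τ (Polynomial.aeval (v i) g) = Polynomial.aeval (v (e i)) g := by
      rw [← he]
      exact (Polynomial.aeval_algHom_apply (τ : K →+* K).toIntAlgHom (v i) g).symm
    by_cases h : v i ≠ 0
    · rw [if_pos h, if_pos (h1.2 h), h2]
    · rw [if_neg h, if_neg (h1.not.2 h), map_zero]
  obtain ⟨r, hr⟩ := (IsGalois.mem_bot_iff_fixed _).2 hfix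
  obtain ⟨Z, hZ⟩ : ∃ Z : ℤ, (D : K) ^ (p * d) * ∑ i ∈ J, Polynomial.aeval (v i) g = Z := by
    have h1 : IsIntegral ℤ ((D : K) ^ (p * d) * ∑ i ∈ J, Polynomial.aeval (v i) g) := by
      rw [Finset.mul_sum]
      refine IsIntegral.sum _ fun i hi => ?_
      have := isIntegral_pow_mul_aeval (D : ℤ) (v i) (by simpa using h_integral i hi) g (p * d) (by omega)
      simpa using this
    have h2 : (D : K) ^ (p * d) * ∑ i ∈ J, Polynomial.aeval (v i) g =
        algebraMap ℚ K ((D : ℚ) ^ (p * d) * r) := by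
      rw [← hr]
      simp
    rw [h2, isIntegral_algebraMap_iff (algebraMap ℚ K).injective] at h1
    obtain ⟨Z, hZ⟩ := IsIntegrallyClosed.isIntegral_iff.1 h1
    refine ⟨Z, ?_⟩
    rw [h2, ← hZ]
    simp
  have hZ' : (D : ℂ) ^ (p * d) * ∑ i ∈ J, Polynomial.aeval (σ (v i)) g = Z := by
    have := congrArg σ hZ
    simpa [haeval] using this
  have hkey : ((n * m * D ^ (p * d) + p * Z : ℤ) : ℂ) = -((D : ℂ) ^ (p * d) *
      ∑ i ∈ J, (n • Complex.exp (σ (v i)) - p • Polynomial.aeval (σ (v i)) g)) := by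
    rw [Finset.sum_sub_distrib, ← Finset.smul_sum, ← Finset.smul_sum]
    push_cast
    rw [← hZ', eq_neg_of_add_eq_zero_right hsum']
    simp only [zsmul_eq_mul, nsmul_eq_mul]
    ring
  have hlt : ‖((n * m * D ^ (p * d) + p * Z : ℤ) : ℂ)‖ < 1 := by
    rw [hkey, norm_neg, norm_mul, norm_pow, Complex.norm_natCast]
    refine lt_of_le_of_lt ?_ (hM p hpM)
    calc _ ≤ (D : ℝ) ^ (p * d) * (J.card • (c ^ p / (p - 1).factorial)) := by
          gcongr
          refine (norm_sum_le _ _).trans (Finset.sum_le_card_nsmul _ _ _ fun i hi => ?_)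
          exact hg (hroot i hi)
      _ = _ := by
          rw [nsmul_eq_mul, mul_pow, ← pow_mul, mul_comm p d]
          ring
  have hzero : n * m * D ^ (p * d) + p * Z = 0 := by
    rw [Complex.norm_intCast] at hlt
    exact Int.abs_lt_one_iff.1 (by exact_mod_cast hlt)
  have hpZ : Prime (p : ℤ) := Nat.prime_iff_prime_int.1 hp
  have hdvd : (p : ℤ) ∣ n * m * D ^ (p * d) :=
    (dvd_add_left (dvd_mul_right _ _)).1 (hzero ▸ dvd_zero _)
  rcases hpZ.dvd_or_dvd hdvd with h | h
  · rcases hpZ.dvd_or_dvd h with h | h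
    · exact hn h
    · have := Nat.le_of_dvd hmpos (Int.natCast_dvd_natCast.1 h)
      omega
  · have := Nat.le_of_dvd hD (Int.natCast_dvd_natCast.1 (hpZ.dvd_of_dvd_pow h))
    omega

theorem exp_ne_neg_one_of_isAlgebraic {x : ℂ} (hx : IsAlgebraic ℚ x) : Complex.exp x ≠ -1 := by
  classical
  intro hexp
  let P := minpoly ℚ x
  let K := IntermediateField.adjoin ℚ (P.rootSet ℂ)
  have hsplit : Polynomial.IsSplittingField ℚ K P :=
    IntermediateField.adjoin_rootSet_isSplittingField (IsAlgClosed.splits _)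
  have hgal : IsGalois ℚ K :=
    IsGalois.of_separable_splitting_field (p := P) (minpoly.irreducible hx.isIntegral).separable
  have hfd : FiniteDimensional ℚ K := Polynomial.IsSplittingField.finiteDimensional K P
  have hnf : NumberField K := { to_charZero := inferInstance, to_finiteDimensional := hfd }
  have hxK : x ∈ K := IntermediateField.subset_adjoin _ _
    ((Polynomial.mem_rootSet_of_ne (minpoly.ne_zero hx.isIntegral)).2 (minpoly.aeval ℚ x))
  let y : K := ⟨x, hxK⟩
  let σ : K →+* ℂ := algebraMap K ℂ
  let v : Finset (K ≃ₐ[ℚ] K) → K := fun S => ∑ τ ∈ S, τ y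
  refine sum_exp_ne_zero σ v ∅ (by simp [v]) ?_ ?_
  · intro τ
    refine ⟨(Equiv.mulLeft τ).finsetCongr, fun S => ?_⟩
    simp [v, Equiv.finsetCongr, map_sum]
  · have h1 : ∏ τ : K ≃ₐ[ℚ] K, (1 + Complex.exp (σ (τ y))) = 0 := by
      refine Finset.prod_eq_zero (Finset.mem_univ 1) ?_
      have : σ ((1 : K ≃ₐ[ℚ] K) y) = x := rfl
      rw [this, hexp]
      ring
    rw [Finset.prod_one_add, Finset.powerset_univ] at h1
    rw [← h1]
    refine Finset.sum_congr rfl fun S _ => ?_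
    simp only [v, map_sum, Complex.exp_sum]

/-- If `α` is an algebraic integer with `|α| ≠ 1`, then no value of `log α` is of the form
`β₀ + β₁ · 2πi` with `β₀`, `β₁` algebraic. -/
theorem exp_algebraic_combination_ne {α β₀ β₁ : ℂ} (hα : IsIntegral ℤ α) (hna : ‖α‖ ≠ 1)
    (hβ₀ : IsAlgebraic ℚ β₀) (hβ₁ : IsAlgebraic ℚ β₁) :
    Complex.exp (β₀ + β₁ * (2 * Real.pi * Complex.I)) ≠ α := by
  intro hexp
  let S : Set ℂ := {α, β₀, β₁}
  let K := IntermediateField.adjoin ℚ S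
  have hmem : ∀ x ∈ S, x ∈ K := fun x hx => IntermediateField.subset_adjoin _ _ hx
  have hfd : FiniteDimensional ℚ K := by
    have : Finite S := Set.toFinite S
    refine IntermediateField.finiteDimensional_adjoin ?_
    rintro x (rfl | rfl | rfl)
    · exact hα.tower_top
    · exact hβ₀.isIntegral
    · exact hβ₁.isIntegral
  have hnf : NumberField K := { to_charZero := inferInstance, to_finiteDimensional := hfd }
  let σ : K →+* ℂ := algebraMap K ℂ
  let x₀ : K := ⟨β₀, hmem _ (by simp [S])⟩
  let x₁ : K := ⟨β₁, hmem _ (by simp [S])⟩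
  let y : K := ⟨α, hmem _ (by simp [S])⟩
  obtain ⟨D, hD, h_integral⟩ := exists_common_denominator Finset.univ ![x₀, x₁]
  have h₀ : IsIntegral ℤ ((D : K) * x₀) := h_integral 0 (Finset.mem_univ _)
  have h₁ : IsIntegral ℤ ((D : K) * x₁) := h_integral 1 (Finset.mem_univ _)
  have hy : IsIntegral ℤ y := (isIntegral_algebraMap_iff (algebraMap K ℂ).injective).1 hα
  have key := norm_eq_one_of_eq_exp σ ⟨_, h₀⟩ ⟨_, h₁⟩ ⟨_, hy.pow D⟩ (by
    have hσ : σ ((D : K) * x₀) = D * β₀ := by rw [map_mul, map_natCast]; rfl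
    have hσ' : σ ((D : K) * x₁) = D * β₁ := by rw [map_mul, map_natCast]; rfl
    have hσy : σ (y ^ D) = α ^ D := by rw [map_pow]; rfl
    change σ (y ^ D) = Complex.exp (σ (D * x₀) + σ (D * x₁) * _)
    rw [hσ, hσ', hσy, ← hexp, ← Complex.exp_nat_mul]
    ring_nf)
  have hσy : σ (y ^ D) = α ^ D := by rw [map_pow]; rfl
  change ‖σ (y ^ D)‖ = 1 at key
  rw [hσy, norm_pow, pow_eq_one_iff_of_nonneg (norm_nonneg _) hD.ne'] at key
  exact hna key

theorem norm_one_sub_ne_one_of_isPrimitiveRoot {N : ℕ} (hN : 2 ≤ N) (hN6 : N ≠ 6) {ξ : ℂ}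
    (hξ : IsPrimitiveRoot ξ N) : ‖1 - ξ‖ ≠ 1 := by
  intro h
  have h1 : ‖ξ‖ = 1 := hξ.norm'_eq_one (by omega)
  have h2 : ξ ^ 2 = ξ - 1 := by
    have e1 : ξ.re * ξ.re + ξ.im * ξ.im = 1 := by
      rw [← Complex.normSq_apply, Complex.normSq_eq_norm_sq, h1, one_pow]
    have e2 : (1 - ξ.re) * (1 - ξ.re) + ξ.im * ξ.im = 1 := by
      have := Complex.normSq_apply (1 - ξ)
      rw [Complex.normSq_eq_norm_sq, h] at this
      simp at this
      linarith
    have e3 : ξ.re = 1 / 2 := by linarith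
    have e4 : ξ.im * ξ.im = 3 / 4 := by
      rw [e3] at e1
      linarith
    apply Complex.ext
    · rw [sq, Complex.mul_re, e4, e3, Complex.sub_re, e3]
      norm_num
    · rw [sq, Complex.mul_im, e3]
      simp
      ring
  have h3 : ξ ^ 3 = -1 := by
    linear_combination (ξ + 1) * h2
  have h6 : ξ ^ 6 = 1 := by
    linear_combination (ξ ^ 3 - 1) * h3
  have hdvd : N ∣ 6 := hξ.dvd_of_pow_eq_one 6 h6
  have hle := Nat.le_of_dvd (by norm_num) hdvd
  have hNpow := hξ.pow_eq_one
  interval_cases N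
  · have : ξ = 2 := by linear_combination h2.symm.trans hNpow
    rw [this] at hNpow
    norm_num at hNpow
  · rw [h3] at hNpow
    norm_num at hNpow
  all_goals omega

theorem statement12 (N : ℕ) (hN : 2 ≤ N) (hN6 : N ≠ 6) (ξ : ℂ)
    (hξ : ξ ^ N = 1) (hprim : ∀ m : ℕ, 0 < m → m < N → ξ ^ m ≠ 1) :
    (∀ a b : ℚ, (a : ℂ) * Complex.log (1 - ξ) + (b : ℂ) * ((Real.pi : ℂ) * Complex.I) = 0 →
      a = 0 ∧ b = 0) ∧
    (∀ a b c : ℂ, IsAlgebraic ℚ a → IsAlgebraic ℚ b → IsAlgebraic ℚ c →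
      a * 1 + b * Complex.log (1 - ξ) + c * ((Real.pi : ℂ) * Complex.I) = 0 →
      a = 0 ∧ b = 0 ∧ c = 0) := by
  have hpr : IsPrimitiveRoot ξ N := IsPrimitiveRoot.mk_of_lt ξ (by omega) hξ hprim
  have hna := norm_one_sub_ne_one_of_isPrimitiveRoot hN hN6 hpr
  have hne : 1 - ξ ≠ 0 := sub_ne_zero.2 (hpr.ne_one (by omega)).symm
  have hπ : (Real.pi : ℂ) * Complex.I ≠ 0 :=
    mul_ne_zero (by exact_mod_cast Real.pi_ne_zero) Complex.I_ne_zero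
  have main : ∀ a b c : ℂ, IsAlgebraic ℚ a → IsAlgebraic ℚ b → IsAlgebraic ℚ c →
      a * 1 + b * Complex.log (1 - ξ) + c * ((Real.pi : ℂ) * Complex.I) = 0 →
      a = 0 ∧ b = 0 ∧ c = 0 := by
    intro a b c ha hb hc h
    have hb0 : b = 0 := by
      by_contra hb0
      have h_integral : IsIntegral ℤ (1 - ξ) := isIntegral_one.sub (hpr.isIntegral (by omega))
      have h2 : IsAlgebraic ℚ (2 : ℂ) := by simpa using isAlgebraic_algebraMap (A := ℂ) (2 : ℚ)
      refine exp_algebraic_combination_ne h_integral hna (ha.neg.mul hb.inv)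
        (hc.neg.mul (h2.mul hb).inv) ?_
      rw [← Complex.exp_log hne]
      congr 1
      field_simp
      linear_combination -h
    subst hb0
    have hc0 : c = 0 := by
      by_contra hc0
      refine exp_ne_neg_one_of_isAlgebraic (ha.neg.mul hc.inv) ?_
      rw [← Complex.exp_pi_mul_I]
      congr 1
      field_simp
      linear_combination -h
    subst hc0
    exact ⟨by simpa using h, rfl, rfl⟩
  refine ⟨fun a b h => ?_, main⟩
  have := main 0 a b isAlgebraic_zero (isAlgebraic_algebraMap a) (isAlgebraic_algebraMap b)
    (by simpa using h)
  exact ⟨by exact_mod_cast this.2.1, by exact_mod_cast this.2.2⟩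

end
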